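/- Let m ≥ 2 and n ≥ 2m − 1 be integers and define F : (−1, 1) → ℝ by F(r) = ⨍_{−1}^{1} U_n(s)·(1−s²)^{m−1/2}/(s−r) ds (Cauchy principal value). Then F is differentiable at every r ∈ (−1, 1) and F′(r) = π·(−1)^m·(1/2)^{2m−2} · Σ_{j=0}^{2m−2} (−1)^j · C(2m−2, j) · (n+3−2m+2j) · U_{n+2−2m+2j}(r), where C(2m−2, j) denotes the binomial coefficient. (F′(r) is the Hadamard finite-part integral ⨎_{−1}^{1} U_n(s)·(1−s²)^{m−1/2}/(s−r)² ds.) -/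

import Mathlib

open Polynomial.Chebyshev in
theorem aux_fwd (s : ℝ) (p : ℕ) : ∀ y : ℤ,
    ((fwdDiff (2 : ℤ))^[2 * p] (fun k : ℤ => (U ℝ k).eval s)) y
      = (-4 * (1 - s ^ 2)) ^ p * (U ℝ (y + 2 * p)).eval s := by
  induction p with
  | zero => intro y; simp
  | succ p ih =>
    intro y
    rw [show 2 * (p + 1) = 2 * p + 1 + 1 by ring, Function.iterate_succ_apply',
      Function.iterate_succ_apply']
    simp only [fwdDiff, ih]
    set z : ℤ := y + 2 * p with hz
    have e1 : y + 2 + 2 + 2 * (p : ℤ) = z + 4 := by omega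
    have e2 : y + 2 + 2 * (p : ℤ) = z + 2 := by omega
    have e3 : y + 2 * ((p + 1 : ℕ) : ℤ) = z + 2 := by push_cast; omega
    rw [e1, e2, e3]
    have h1 := congrArg (Polynomial.eval s) (U_add_two ℝ (z + 2))
    have h2 := congrArg (Polynomial.eval s) (U_add_two ℝ (z + 1))
    have h3 := congrArg (Polynomial.eval s) (U_add_two ℝ z)
    rw [show z + 2 + 2 = z + 4 by ring, show z + 2 + 1 = z + 3 by ring] at h1
    rw [show z + 1 + 2 = z + 3 by ring, show z + 1 + 1 = z + 2 by ring] at h2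
    simp only [Polynomial.eval_sub, Polynomial.eval_mul, Polynomial.eval_X,
      Polynomial.eval_ofNat] at h1 h2 h3
    rw [pow_succ]
    linear_combination (-4 * (1 - s ^ 2)) ^ p * (h1 + 2 * s * h2 + h3)

open Polynomial.Chebyshev in
theorem aux_expand (s : ℝ) (p q : ℕ) :
    (U ℝ ((q + 2 * p : ℕ) : ℤ)).eval s * (1 - s ^ 2) ^ p =
      ∑ j ∈ Finset.range (2 * p + 1), ((-1 / 4 : ℝ) ^ p * ((-1) ^ j * (Nat.choose (2 * p) j : ℝ))) *
        (U ℝ ((q + 2 * j : ℕ) : ℤ)).eval s := by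
  have h := aux_fwd s p (q : ℤ)
  rw [fwdDiff_iter_eq_sum_shift, mul_pow] at h
  have h4 : (-1 / 4 : ℝ) ^ p * (-4) ^ p = 1 := by rw [← mul_pow]; norm_num
  have h5 : (U ℝ ((q + 2 * p : ℕ) : ℤ)).eval s * (1 - s ^ 2) ^ p
      = (-1 / 4 : ℝ) ^ p * ((-4) ^ p * (1 - s ^ 2) ^ p * (U ℝ ((q : ℤ) + 2 * p)).eval s) := by
    push_cast
    linear_combination - (U ℝ ((q : ℤ) + 2 * p)).eval s * (1 - s ^ 2) ^ p * h4
  rw [h5, ← h, Finset.mul_sum]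
  refine Finset.sum_congr rfl fun j hj => ?_
  have hj' : j ≤ 2 * p := by simp at hj; omega
  have h6 : (-1 : ℝ) ^ (2 * p - j) = (-1) ^ j := by
    have : (-1 : ℝ) ^ (2 * p - j) * (-1) ^ j = 1 := by
      rw [← pow_add, Nat.sub_add_cancel hj']; simp [pow_mul]
    rcases neg_one_pow_eq_or ℝ j with h | h <;> rw [h] at this ⊢ <;> linarith
  rw [zsmul_eq_mul]
  push_cast
  rw [h6, nsmul_eq_mul, mul_comm (j : ℤ) 2]
  ring

open Polynomial.Chebyshev in
theorem aux_orth (k : ℕ) :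
    ∫ s in (-1 : ℝ)..1, (U ℝ (k : ℤ)).eval s * √(1 - s ^ 2) = if k = 0 then Real.pi / 2 else 0 := by
  have h1 : ∫ s in (-1 : ℝ)..1, (U ℝ (k : ℤ)).eval s * √(1 - s ^ 2)
      = ∫ s in (-1 : ℝ)..1, ((1 / 2 : ℝ) * ((T ℝ (k : ℤ)).eval s - (T ℝ ((k : ℤ) + 2)).eval s))
          * √(1 - s ^ 2)⁻¹ := by
    refine intervalIntegral.integral_congr fun s hs => ?_
    rw [Set.uIcc_of_le (by norm_num)] at hs
    have h2 := congrArg (Polynomial.eval s) (one_sub_X_sq_mul_U_eq_pol_in_T ℝ (k : ℤ))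
    have h3 := congrArg (Polynomial.eval s) (T_add_two ℝ (k : ℤ))
    simp only [Polynomial.eval_sub, Polynomial.eval_mul, Polynomial.eval_X, Polynomial.eval_pow,
      Polynomial.eval_ofNat, Polynomial.eval_one] at h2 h3
    have h0 : 0 ≤ 1 - s ^ 2 := by nlinarith [hs.1, hs.2]
    have h4 : (1 / 2 : ℝ) * ((T ℝ (k : ℤ)).eval s - (T ℝ ((k : ℤ) + 2)).eval s)
        = (1 - s ^ 2) * (U ℝ (k : ℤ)).eval s := by
      linear_combination - h2 + h3 / 2
    beta_reduce
    rw [h4, Real.sqrt_inv]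
    have h5 : (1 - s ^ 2) * (√(1 - s ^ 2))⁻¹ = √(1 - s ^ 2) := by
      rw [← div_eq_mul_inv, Real.div_sqrt]
    linear_combination (-(U ℝ (k : ℤ)).eval s) * h5
  rw [h1, ← integral_measureT, MeasureTheory.integral_const_mul, MeasureTheory.integral_sub
    (integrable_measureT (by fun_prop)) (integrable_measureT (by fun_prop)),
    integral_eval_T_real_measureT_of_ne_zero (n := (k : ℤ) + 2) (by omega)]
  split_ifs with hk
  · subst hk
    have := integral_eval_T_real_measureT_zero
    simp only [Nat.cast_zero]
    rw [this]; ring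
  · rw [integral_eval_T_real_measureT_of_ne_zero (by exact_mod_cast hk)]; simp

/-- principal value predicate -/
def PVT (r : ℝ) (g : ℝ → ℝ) (L : ℝ) : Prop :=
  Filter.Tendsto
    (fun ε : ℝ => (∫ s in (-1 : ℝ)..(r - ε), g s / (s - r)) + ∫ s in (r + ε)..(1 : ℝ), g s / (s - r))
    (nhdsWithin 0 (Set.Ioi 0)) (nhds L)

theorem ev_small (r : ℝ) (hr : r ∈ Set.Ioo (-1 : ℝ) 1) :
    ∀ᶠ ε in nhdsWithin (0 : ℝ) (Set.Ioi 0), 0 < ε ∧ -1 < r - ε ∧ r + ε < 1 := by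
  have h : Set.Ioo (0 : ℝ) (min (r + 1) (1 - r)) ∈ nhdsWithin (0 : ℝ) (Set.Ioi 0) :=
    Ioo_mem_nhdsGT (lt_min (by linarith [hr.1]) (by linarith [hr.2]))
  filter_upwards [h] with ε hε
  have h1 := lt_of_lt_of_le hε.2 (min_le_left _ _)
  have h2 := lt_of_lt_of_le hε.2 (min_le_right _ _)
  exact ⟨hε.1, by linarith, by linarith⟩

theorem ii_left {r ε : ℝ} (hε : 0 < ε) (h1 : -1 < r - ε) (h2 : r + ε < 1) {g : ℝ → ℝ}
    (hg : ContinuousOn g (Set.Icc (-1) 1)) :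
    IntervalIntegrable (fun s => g s / (s - r)) MeasureTheory.volume (-1) (r - ε) := by
  apply ContinuousOn.intervalIntegrable
  rw [Set.uIcc_of_le h1.le]
  refine ContinuousOn.div (hg.mono (Set.Icc_subset_Icc le_rfl (by linarith))) (by fun_prop) ?_
  intro x hx; have := hx.2; intro h; linarith

theorem ii_right {r ε : ℝ} (hε : 0 < ε) (h1 : -1 < r - ε) (h2 : r + ε < 1) {g : ℝ → ℝ}
    (hg : ContinuousOn g (Set.Icc (-1) 1)) :
    IntervalIntegrable (fun s => g s / (s - r)) MeasureTheory.volume (r + ε) 1 := by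
  apply ContinuousOn.intervalIntegrable
  rw [Set.uIcc_of_le h2.le]
  refine ContinuousOn.div (hg.mono (Set.Icc_subset_Icc (by linarith) le_rfl)) (by fun_prop) ?_
  intro x hx; have := hx.1; intro h; linarith

theorem PVT.congr {r : ℝ} (hr : r ∈ Set.Ioo (-1 : ℝ) 1) {g g' : ℝ → ℝ} {L : ℝ} (h : PVT r g L)
    (hgg : ∀ s ∈ Set.Icc (-1 : ℝ) 1, g s = g' s) : PVT r g' L := by
  refine Filter.Tendsto.congr' ?_ h
  filter_upwards [ev_small r hr] with ε hε
  obtain ⟨h0, h1, h2⟩ := hε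
  congr 1
  · refine intervalIntegral.integral_congr fun s hs => ?_
    rw [Set.uIcc_of_le h1.le] at hs
    simp only [hgg s ⟨hs.1, by linarith [hs.2]⟩]
  · refine intervalIntegral.integral_congr fun s hs => ?_
    rw [Set.uIcc_of_le h2.le] at hs
    simp only [hgg s ⟨by linarith [hs.1], hs.2⟩]

theorem PVT.const_mul {r : ℝ} {g : ℝ → ℝ} {L : ℝ} (h : PVT r g L) (c : ℝ) :
    PVT r (fun s => c * g s) (c * L) := by
  have := Filter.Tendsto.const_mul c h
  refine this.congr fun ε => ?_
  simp only [mul_div_assoc, intervalIntegral.integral_const_mul]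
  ring

theorem PVT.add {r : ℝ} (hr : r ∈ Set.Ioo (-1 : ℝ) 1) {g g' : ℝ → ℝ} {L L' : ℝ}
    (hg : ContinuousOn g (Set.Icc (-1) 1)) (hg' : ContinuousOn g' (Set.Icc (-1) 1))
    (h : PVT r g L) (h' : PVT r g' L') : PVT r (fun s => g s + g' s) (L + L') := by
  refine Filter.Tendsto.congr' ?_ (Filter.Tendsto.add h h')
  filter_upwards [ev_small r hr] with ε hε
  obtain ⟨h0, h1, h2⟩ := hε
  simp only [add_div]
  rw [intervalIntegral.integral_add (ii_left h0 h1 h2 hg) (ii_left h0 h1 h2 hg'),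
    intervalIntegral.integral_add (ii_right h0 h1 h2 hg) (ii_right h0 h1 h2 hg')]
  ring

theorem PVT.sum {r : ℝ} (hr : r ∈ Set.Ioo (-1 : ℝ) 1) (S : Finset ℕ) (g : ℕ → ℝ → ℝ) (L : ℕ → ℝ)
    (hg : ∀ i, ContinuousOn (g i) (Set.Icc (-1) 1)) (h : ∀ i, PVT r (g i) (L i)) :
    PVT r (fun s => ∑ i ∈ S, g i s) (∑ i ∈ S, L i) := by
  induction S using Finset.induction_on with
  | empty => simp [PVT]
  | insert a S ha ih =>
    simp only [Finset.sum_insert ha]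
    exact PVT.add hr (hg a) (by fun_prop) (h a) ih

theorem PVT.regular {r : ℝ} (hr : r ∈ Set.Ioo (-1 : ℝ) 1) {g : ℝ → ℝ} (hg : Continuous g) :
    PVT r (fun s => (s - r) * g s) (∫ s in (-1 : ℝ)..1, g s) := by
  have hc : Continuous (fun ε : ℝ => (∫ s in (-1 : ℝ)..(r - ε), g s) +
      ((∫ s in (-1 : ℝ)..1, g s) - ∫ s in (-1 : ℝ)..(r + ε), g s)) := by
    have := intervalIntegral.continuous_primitive (fun a b => hg.intervalIntegrable a b) (-1)
      (μ := MeasureTheory.volume)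
    have a1 := this.comp (by fun_prop : Continuous fun ε : ℝ => r - ε)
    have a2 := this.comp (by fun_prop : Continuous fun ε : ℝ => r + ε)
    exact a1.add (continuous_const.sub a2)
  have ht := (hc.tendsto 0).mono_left (nhdsWithin_le_nhds (s := Set.Ioi 0))
  simp only [sub_zero, add_zero, add_sub_cancel] at ht
  refine ht.congr' ?_
  filter_upwards [ev_small r hr] with ε hε
  obtain ⟨h0, h1, h2⟩ := hε
  rw [intervalIntegral.integral_interval_sub_left (hg.intervalIntegrable _ _)
    (hg.intervalIntegrable _ _)]
  congr 1
  · refine intervalIntegral.integral_congr fun s hs => ?_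
    rw [Set.uIcc_of_le h1.le] at hs
    have : s - r ≠ 0 := by have := hs.2; intro h; linarith
    field_simp
  · refine intervalIntegral.integral_congr fun s hs => ?_
    rw [Set.uIcc_of_le h2.le] at hs
    have : s - r ≠ 0 := by have := hs.1; intro h; linarith
    field_simp

/-- antiderivative -/
noncomputable def GG (r s : ℝ) : ℝ :=
  √(1 - r ^ 2) * (Real.log (s - r) - Real.log (1 - r * s + √(1 - r ^ 2) * √(1 - s ^ 2)))
    + √(1 - s ^ 2) - r * Real.arcsin s

theorem den_pos {r s : ℝ} (hr : r ∈ Set.Ioo (-1 : ℝ) 1) (hs : s ∈ Set.Icc (-1 : ℝ) 1) :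
    0 < 1 - r * s + √(1 - r ^ 2) * √(1 - s ^ 2) := by
  have : 0 ≤ √(1 - r ^ 2) * √(1 - s ^ 2) := by positivity
  have h2 : 0 < 1 - r * s := by
    obtain ⟨a, b⟩ := hr; obtain ⟨c, d⟩ := hs
    rcases le_total 0 s with h | h <;> nlinarith
  linarith

theorem GG_cont {r : ℝ} (hr : r ∈ Set.Ioo (-1 : ℝ) 1) {A : Set ℝ} (hA : A ⊆ Set.Icc (-1 : ℝ) 1)
    (hrA : r ∉ A) : ContinuousOn (GG r) A := by
  unfold GG
  have h1 : ContinuousOn (fun s : ℝ => Real.log (s - r)) A := by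
    refine ContinuousOn.log (by fun_prop) fun x hx => ?_
    intro h; apply hrA; rwa [← sub_eq_zero.mp h]
  have h2 : ContinuousOn (fun s : ℝ => Real.log (1 - r * s + √(1 - r ^ 2) * √(1 - s ^ 2))) A :=
    ContinuousOn.log (by fun_prop) fun x hx => (den_pos hr (hA hx)).ne'
  have h3 : Continuous (fun s : ℝ => r * Real.arcsin s) :=
    continuous_const.mul Real.continuous_arcsin
  exact ((continuousOn_const.mul (h1.sub h2)).add (by fun_prop)).sub h3.continuousOn

theorem GG_deriv {r s : ℝ} (hr : r ∈ Set.Ioo (-1 : ℝ) 1) (hs : s ∈ Set.Ioo (-1 : ℝ) 1)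
    (hrs : s ≠ r) : HasDerivAt (GG r) (√(1 - s ^ 2) / (s - r)) s := by
  have hd := den_pos hr (Set.Ioo_subset_Icc_self hs)
  have hs0 : 0 < 1 - s ^ 2 := by nlinarith [hs.1, hs.2]
  have hr0 : 0 < 1 - r ^ 2 := by nlinarith [hr.1, hr.2]
  have hq : HasDerivAt (fun s : ℝ => √(1 - s ^ 2)) (-(2 * s) / (2 * √(1 - s ^ 2))) s := by
    have : HasDerivAt (fun s : ℝ => 1 - s ^ 2) (-(2 * s)) s := by
      simpa using (hasDerivAt_pow 2 s).const_sub 1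
    exact this.sqrt hs0.ne'
  have hl1 : HasDerivAt (fun s : ℝ => Real.log (s - r)) (1 / (s - r)) s :=
    ((hasDerivAt_id s).sub_const r).log (sub_ne_zero.mpr hrs)
  have hD : HasDerivAt (fun s : ℝ => 1 - r * s + √(1 - r ^ 2) * √(1 - s ^ 2))
      (-r + √(1 - r ^ 2) * (-(2 * s) / (2 * √(1 - s ^ 2)))) s := by
    have : HasDerivAt (fun s : ℝ => 1 - r * s) (-r) s := by
      simpa using ((hasDerivAt_id s).const_mul r).const_sub 1
    exact this.add (hq.const_mul _)
  have hl2 := hD.log hd.ne'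
  have ha := (Real.hasDerivAt_arcsin hs.1.ne' hs.2.ne).const_mul r
  have hG := (((hl1.sub hl2).const_mul (√(1 - r ^ 2))).add hq).sub ha
  refine HasDerivAt.congr_deriv (f := GG r) hG ?_
  have hsr : s - r ≠ 0 := sub_ne_zero.mpr hrs
  set a := √(1 - r ^ 2) with haa
  set b := √(1 - s ^ 2) with hbb
  have ha2 : a ^ 2 = 1 - r ^ 2 := Real.sq_sqrt hr0.le
  have hb2 : b ^ 2 = 1 - s ^ 2 := Real.sq_sqrt hs0.le
  have hb : 0 < b := Real.sqrt_pos.mpr hs0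
  have hd' := hd.ne'
  have key : a * (1 / (s - r) - (-r + a * (-(2 * s) / (2 * b))) / (1 - r * s + a * b))
      = a ^ 2 / (b * (s - r)) := by
    rw [div_sub_div _ _ hsr hd', mul_div_assoc', div_eq_div_iff (mul_ne_zero hsr hd')
      (mul_ne_zero hb.ne' hsr)]
    field_simp
    have : b * (1 - r * s + a * b - (s - r) * -r) + (s - r) * s * a
        = a * (1 - r * s + a * b) := by
      linear_combination a * hb2 - b * ha2
    linear_combination a * this
  rw [key]
  field_simp
  rw [ha2, hb2]; ring

theorem PVT_zero {r : ℝ} (hr : r ∈ Set.Ioo (-1 : ℝ) 1) :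
    PVT r (fun s => √(1 - s ^ 2)) (-(Real.pi * r)) := by
  set D : ℝ → ℝ := fun s => √(1 - r ^ 2) * Real.log (1 - r * s + √(1 - r ^ 2) * √(1 - s ^ 2))
    - √(1 - s ^ 2) + r * Real.arcsin s with hD
  have hDc : ContinuousAt D r := by
    have h2 : ContinuousAt
        (fun s : ℝ => Real.log (1 - r * s + √(1 - r ^ 2) * √(1 - s ^ 2))) r :=
      ContinuousAt.log (by fun_prop) (den_pos hr (Set.Ioo_subset_Icc_self hr)).ne'
    have h3 : Continuous (fun s : ℝ => r * Real.arcsin s) :=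
      continuous_const.mul Real.continuous_arcsin
    exact ((continuousAt_const.mul h2).sub (by fun_prop)).add h3.continuousAt
  have t1 : Filter.Tendsto (fun ε : ℝ => D (r + ε)) (nhds 0) (nhds (D r)) := by
    refine Filter.Tendsto.comp (y := nhds r) hDc ?_
    have : Continuous fun ε : ℝ => r + ε := by fun_prop
    simpa using this.tendsto 0
  have t2 : Filter.Tendsto (fun ε : ℝ => D (r - ε)) (nhds 0) (nhds (D r)) := by
    refine Filter.Tendsto.comp (y := nhds r) hDc ?_
    have : Continuous fun ε : ℝ => r - ε := by fun_prop
    simpa using this.tendsto 0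
  have t3 := ((t1.sub t2).add_const (-(Real.pi * r))).mono_left
    (nhdsWithin_le_nhds (s := Set.Ioi 0))
  rw [sub_self, zero_add] at t3
  refine t3.congr' ?_
  filter_upwards [ev_small r hr] with ε hε
  obtain ⟨h0, h1, h2⟩ := hε
  have hc : ContinuousOn (fun s : ℝ => √(1 - s ^ 2)) (Set.Icc (-1) 1) := by fun_prop
  rw [intervalIntegral.integral_eq_sub_of_hasDerivAt_of_le (f := GG r) h1.le
      (GG_cont hr (Set.Icc_subset_Icc le_rfl (by linarith)) (fun h => by linarith [h.2]))
      (fun x hx => GG_deriv hr ⟨hx.1, by linarith [hx.2]⟩ (by have := hx.2; intro h; linarith))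
      (ii_left h0 h1 h2 hc),
    intervalIntegral.integral_eq_sub_of_hasDerivAt_of_le (f := GG r) h2.le
      (GG_cont hr (Set.Icc_subset_Icc (by linarith) le_rfl) (fun h => by linarith [h.1]))
      (fun x hx => GG_deriv hr ⟨by linarith [hx.1], hx.2⟩ (by have := hx.1; intro h; linarith))
      (ii_right h0 h1 h2 hc)]
  have e1 : GG r (-1) = r * (Real.pi / 2) := by
    have : (-1 - r : ℝ) = -(1 + r) := by ring
    rw [GG, this, Real.log_neg_eq_log]
    simp
  have e2 : GG r 1 = -(r * (Real.pi / 2)) := by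
    simp [GG]
  rw [e1, e2]
  simp only [hD, GG, sub_sub_cancel_left, add_sub_cancel_left, Real.log_neg_eq_log]
  ring

open Polynomial.Chebyshev in
theorem PVT_U {r : ℝ} (hr : r ∈ Set.Ioo (-1 : ℝ) 1) (k : ℕ) :
    PVT r (fun s => (U ℝ (k : ℤ)).eval s * √(1 - s ^ 2))
      (-Real.pi * (T ℝ ((k : ℤ) + 1)).eval r) := by
  have hreg : ∀ k : ℕ, PVT r (fun s => (s - r) * ((U ℝ (k : ℤ)).eval s * √(1 - s ^ 2)))
      (if k = 0 then Real.pi / 2 else 0) := fun k => by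
    rw [← aux_orth k]
    exact PVT.regular hr (g := fun s => (U ℝ (k : ℤ)).eval s * √(1 - s ^ 2)) (by fun_prop)
  induction k using Nat.twoStepInduction with
  | zero =>
    have h := PVT_zero hr
    simpa using h
  | one =>
    have h := PVT.add hr (by fun_prop) (by fun_prop) ((hreg 0).const_mul 2)
      ((PVT_zero hr).const_mul (2 * r))
    convert h.congr hr (g' := fun s => (U ℝ ((1 : ℕ) : ℤ)).eval s * √(1 - s ^ 2)) ?_ using 1
    · norm_num [T_two]; ring
    · intro s _
      simp; ring
  | more k ih1 ih2 =>
    have h := PVT.add hr (by fun_prop) (by fun_prop)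
      (PVT.add hr (by fun_prop) (by fun_prop) ((hreg (k + 1)).const_mul 2) (ih2.const_mul (2 * r)))
      (ih1.const_mul (-1))
    convert h.congr hr (g' := fun s => (U ℝ ((k + 2 : ℕ) : ℤ)).eval s * √(1 - s ^ 2)) ?_ using 1
    · have h3 := congrArg (Polynomial.eval r) (T_add_two ℝ ((k : ℤ) + 1))
      simp only [Polynomial.eval_sub, Polynomial.eval_mul, Polynomial.eval_X,
        Polynomial.eval_ofNat] at h3
      push_cast
      rw [show (k : ℤ) + 2 + 1 = k + 1 + 2 by ring, h3]
      simp
      ring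
    · intro s _
      have h3 := congrArg (Polynomial.eval s) (U_add_two ℝ (k : ℤ))
      simp only [Polynomial.eval_sub, Polynomial.eval_mul, Polynomial.eval_X,
        Polynomial.eval_ofNat] at h3
      push_cast
      rw [h3]
      ring



/-- Let `m ≥ 2`, `n ≥ 2m - 1` and let `F` be the Cauchy principal value
`F(r) = ⨍_{-1}^{1} U_n(s)(1-s²)^{m-1/2}/(s-r) ds` on `(-1,1)`. Then `F` is differentiable on
`(-1,1)` with `F'(r) = π (-1)^m (1/2)^{2m-2} Σ_{j=0}^{2m-2} (-1)^j C(2m-2,j)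
(n+3-2m+2j) U_{n+2-2m+2j}(r)`, the Hadamard finite-part integral
`⨎_{-1}^{1} U_n(s)(1-s²)^{m-1/2}/(s-r)² ds`. -/
theorem hfp2_U_general (m n : ℕ) (hm : 2 ≤ m) (hn : 2 * m - 1 ≤ n) (F : ℝ → ℝ)
    (hF : ∀ r ∈ Set.Ioo (-1 : ℝ) 1,
      Filter.Tendsto
        (fun ε : ℝ =>
          (∫ s in (-1 : ℝ)..(r - ε),
              (Polynomial.Chebyshev.U ℝ n).eval s * (1 - s ^ 2) ^ ((m : ℝ) - 1 / 2) / (s - r)) +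
          ∫ s in (r + ε)..(1 : ℝ),
              (Polynomial.Chebyshev.U ℝ n).eval s * (1 - s ^ 2) ^ ((m : ℝ) - 1 / 2) / (s - r))
        (nhdsWithin 0 (Set.Ioi 0)) (nhds (F r))) :
    ∀ r ∈ Set.Ioo (-1 : ℝ) 1,
      HasDerivAt F
        (Real.pi * (-1 : ℝ) ^ m * (1 / 2 : ℝ) ^ (2 * m - 2) *
          ∑ j ∈ Finset.range (2 * m - 1), (-1 : ℝ) ^ j * (Nat.choose (2 * m - 2) j : ℝ) *
            ((n : ℝ) + 3 - 2 * m + 2 * j) *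
            (Polynomial.Chebyshev.U ℝ ((n : ℤ) + 2 - 2 * m + 2 * j)).eval r) r := by
  obtain ⟨p, rfl⟩ : ∃ p, m = p + 1 := ⟨m - 1, by omega⟩
  obtain ⟨q, rfl⟩ : ∃ q, n = q + 2 * p := ⟨n - 2 * p, by omega⟩
  have hval : ∀ r ∈ Set.Ioo (-1 : ℝ) 1, F r =
      ∑ j ∈ Finset.range (2 * p + 1), ((-1 / 4 : ℝ) ^ p * ((-1) ^ j * (Nat.choose (2 * p) j : ℝ))) *
        (-Real.pi * (Polynomial.Chebyshev.T ℝ (((q + 2 * j : ℕ) : ℤ) + 1)).eval r) := by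
    intro r hr
    have h := PVT.sum hr (Finset.range (2 * p + 1)) _ _ (fun i => by fun_prop)
      (fun j : ℕ => (PVT_U hr (q + 2 * j)).const_mul
        ((-1 / 4 : ℝ) ^ p * ((-1) ^ j * (Nat.choose (2 * p) j : ℝ))))
    refine tendsto_nhds_unique (hF r hr) (h.congr hr fun s hs => ?_)
    have h0 : 0 ≤ 1 - s ^ 2 := by nlinarith [hs.1, hs.2]
    have e : (1 - s ^ 2) ^ (((p + 1 : ℕ) : ℝ) - 1 / 2) = (1 - s ^ 2) ^ p * √(1 - s ^ 2) := by
      rw [Real.sqrt_eq_rpow, ← Real.rpow_natCast (1 - s ^ 2) p, ← Real.rpow_add_of_nonneg h0 (by positivity)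
        (by norm_num)]
      congr 1; push_cast; ring
    rw [e, ← mul_assoc, aux_expand, Finset.sum_mul]
    refine Finset.sum_congr rfl fun j _ => by ring
  intro r hr
  have hev : F =ᶠ[nhds r] fun r =>
      ∑ j ∈ Finset.range (2 * p + 1), ((-1 / 4 : ℝ) ^ p * ((-1) ^ j * (Nat.choose (2 * p) j : ℝ))) *
        (-Real.pi * (Polynomial.Chebyshev.T ℝ (((q + 2 * j : ℕ) : ℤ) + 1)).eval r) := by
    filter_upwards [isOpen_Ioo.mem_nhds hr] with x hx using hval x hx
  refine HasDerivAt.congr_of_eventuallyEq ?_ hev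
  have hd := HasDerivAt.fun_sum (u := Finset.range (2 * p + 1)) (x := r) (fun j _ =>
    (((Polynomial.Chebyshev.T ℝ (((q + 2 * j : ℕ) : ℤ) + 1)).hasDerivAt r).const_mul
      (-Real.pi)).const_mul ((-1 / 4 : ℝ) ^ p * ((-1) ^ j * (Nat.choose (2 * p) j : ℝ))))
  refine hd.congr_deriv ?_
  have e1 : 2 * (p + 1) - 2 = 2 * p := by omega
  have e2 : 2 * (p + 1) - 1 = 2 * p + 1 := by omega
  rw [e1, e2, Finset.mul_sum]
  refine Finset.sum_congr rfl fun j _ => ?_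
  have e3 : ((q + 2 * p : ℕ) : ℤ) + 2 - 2 * ((p + 1 : ℕ) : ℤ) + 2 * (j : ℤ)
      = ((q + 2 * j : ℕ) : ℤ) + 1 - 1 := by push_cast; ring
  have e4 : (-1 / 4 : ℝ) ^ p = (-1) ^ p * (1 / 2) ^ (2 * p) := by
    rw [pow_mul, ← mul_pow]; norm_num
  rw [e3, Polynomial.Chebyshev.T_derivative_eq_U, e4, pow_succ]
  simp only [Polynomial.eval_mul, Polynomial.eval_intCast]
  push_cast
  ring
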